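/- arXiv:1110.4050 — 5 statements merged into one kernel-verified Lean document; each statement's English description precedes it below -/
import Mathlib

section
/- Let (Ω, ℙ) be a probability space and let γ : Ω → ℝ be measurable and integrable with γ(ω) > 0 for ℙ-almost every ω. Let a ∈ (0,1], b > 0, r > 0, and let D : ℝ → ℝ be measurable, antitone on [(1−a)·r, r] and strictly positive on [(1−a)·r, r]. Then the map P ↦ ∫ D((1 − a·exp(−b·P·γ(ω)))·r) · γ(ω) · exp(−b·P·γ(ω)) dℙ(ω) is well defined (the integrand is dominated by D((1−a)·r)·γ) and strictly antitone on [0, ∞). -/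
open MeasureTheory

lemma integral_lt_integral_of_ae_lt {Ω : Type*} [MeasurableSpace Ω] {μ : Measure Ω} [NeZero μ]
    {f g : Ω → ℝ} (hf : Integrable f μ) (hg : Integrable g μ) (h : ∀ᵐ ω ∂μ, f ω < g ω) :
    ∫ ω, f ω ∂μ < ∫ ω, g ω ∂μ := by
  refine lt_of_le_of_ne (integral_mono_ae hf hg (h.mono fun _ hω => hω.le)) fun heq => ?_
  have hae := (integral_eq_iff_of_ae_le hf hg (h.mono fun _ hω => hω.le)).1 heq
  obtain ⟨ω, hlt, he⟩ := (h.and hae).exists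
  exact hlt.ne he

lemma one_sub_mul_exp_neg_mul_mem_Icc {a r t : ℝ} (ha : 0 ≤ a) (hr : 0 ≤ r) (ht : 0 ≤ t) :
    (1 - a * Real.exp (-t)) * r ∈ Set.Icc ((1 - a) * r) r := by
  have h1 : Real.exp (-t) ≤ 1 := Real.exp_le_one_iff.2 (by linarith)
  have h2 : a * Real.exp (-t) ≤ a := mul_le_of_le_one_right ha h1
  have h3 : 0 ≤ a * Real.exp (-t) := by positivity
  exact ⟨mul_le_mul_of_nonneg_right (by linarith) hr, mul_le_of_le_one_left hr (by linarith)⟩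

theorem stmt_3 {Ω : Type*} [MeasurableSpace Ω] (Pr : Measure Ω)
    [IsProbabilityMeasure Pr] (γ : Ω → ℝ) (hγmeas : Measurable γ)
    (hγint : Integrable γ Pr) (hγ0 : ∀ᵐ ω ∂Pr, 0 < γ ω)
    (a b r : ℝ) (ha : 0 < a) (ha1 : a ≤ 1) (hb : 0 < b) (hr : 0 < r)
    (D : ℝ → ℝ) (hDmeas : Measurable D)
    (hDanti : AntitoneOn D (Set.Icc ((1 - a) * r) r))
    (hDpos : ∀ x ∈ Set.Icc ((1 - a) * r) r, 0 < D x) :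
    (∀ P : ℝ, 0 ≤ P →
      Integrable
        (fun ω =>
          D ((1 - a * Real.exp (-(b * P * γ ω))) * r) * γ ω *
            Real.exp (-(b * P * γ ω))) Pr) ∧
    StrictAntiOn
      (fun P : ℝ =>
        ∫ ω, D ((1 - a * Real.exp (-(b * P * γ ω))) * r) * γ ω *
          Real.exp (-(b * P * γ ω)) ∂Pr)
      (Set.Ici 0) := by
  have hmem : ∀ P : ℝ, 0 ≤ P → ∀ ω, 0 < γ ω →
      (1 - a * Real.exp (-(b * P * γ ω))) * r ∈ Set.Icc ((1 - a) * r) r :=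
    fun P hP ω hω => one_sub_mul_exp_neg_mul_mem_Icc ha.le hr.le (by positivity)
  have hleft : (1 - a) * r ∈ Set.Icc ((1 - a) * r) r :=
    ⟨le_rfl, mul_le_of_le_one_left hr.le (by linarith)⟩
  have hint : ∀ P : ℝ, 0 ≤ P →
      Integrable
        (fun ω =>
          D ((1 - a * Real.exp (-(b * P * γ ω))) * r) * γ ω *
            Real.exp (-(b * P * γ ω))) Pr := by
    intro P hP
    refine (hγint.const_mul (D ((1 - a) * r))).mono' (by fun_prop) ?_
    filter_upwards [hγ0] with ω hω
    have hm := hmem P hP ω hω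
    have hpos := hDpos _ hm
    have hle := hDanti hleft hm hm.1
    have hexp : Real.exp (-(b * P * γ ω)) ≤ 1 :=
      Real.exp_le_one_iff.2 (neg_nonpos.2 (by positivity))
    rw [Real.norm_of_nonneg (by positivity)]
    exact (mul_le_of_le_one_right (by positivity) hexp).trans
      (mul_le_mul_of_nonneg_right hle hω.le)
  refine ⟨hint, fun P hP Q hQ hPQ => ?_⟩
  refine integral_lt_integral_of_ae_lt (hint Q hQ) (hint P hP) ?_
  filter_upwards [hγ0] with ω hω
  have hexp : Real.exp (-(b * Q * γ ω)) < Real.exp (-(b * P * γ ω)) := by gcongr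
  have hP' := hmem P hP ω hω
  have hQ' := hmem Q hQ ω hω
  have hD := hDanti hP' hQ' (by gcongr)
  have hpos := hDpos _ hP'
  exact mul_lt_mul' (mul_le_mul_of_nonneg_right hD hω.le) hexp (Real.exp_pos _).le
    (mul_pos hpos hω)
end

section
/- Let (Ω, ℙ) be a probability space and let γ : Ω → ℝ be measurable and integrable with γ(ω) > 0 for ℙ-almost every ω. Let a ∈ (0,1], b > 0, r > 0, and let D : ℝ → ℝ be continuous, antitone and strictly positive on [(1−a)·r, r]. Define φ(P) = a·b·r·∫ D((1 − a·exp(−b·P·γ(ω)))·r) · γ(ω) · exp(−b·P·γ(ω)) dℙ(ω) for P ≥ 0, so that φ(0) = a·b·r·D((1−a)·r)·∫ γ dℙ. Then for every μ with 0 < μ ≤ φ(0), there exists a unique P ∈ [0, ∞) such that μ = φ(P). -/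
open MeasureTheory Filter Topology

section ExpectationMulCompExp

variable {Ω : Type*} [MeasurableSpace Ω] {Pr : Measure Ω} {γ : Ω → ℝ} {H : ℝ → ℝ}

theorem ae_norm_mul_comp_exp_le (hγ0 : ∀ᵐ ω ∂Pr, 0 < γ ω)
    (hH : StrictMonoOn H (Set.Icc 0 1)) (hH0 : H 0 = 0) {b P : ℝ} (hb : 0 < b) (hP : 0 ≤ P) :
    ∀ᵐ ω ∂Pr, ‖γ ω * H (Real.exp (-(b * P * γ ω)))‖ ≤ γ ω * H 1 := by
  filter_upwards [hγ0] with ω hω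
  have h1 : Real.exp (-(b * P * γ ω)) ∈ Set.Icc (0 : ℝ) 1 :=
    ⟨(Real.exp_pos _).le, Real.exp_le_one_iff.2 (neg_nonpos.2 (by positivity))⟩
  have h2 : H 0 ≤ H (Real.exp (-(b * P * γ ω))) := hH.monotoneOn (by simp) h1 h1.1
  have h3 : H (Real.exp (-(b * P * γ ω))) ≤ H 1 := hH.monotoneOn h1 (by simp) h1.2
  rw [hH0] at h2
  rw [Real.norm_of_nonneg (by positivity)]
  gcongr

theorem aestronglyMeasurable_mul_comp_exp (hγ : Measurable γ) (hHc : Continuous H) (b P : ℝ) :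
    AEStronglyMeasurable (fun ω ↦ γ ω * H (Real.exp (-(b * P * γ ω)))) Pr :=
  (hγ.mul (hHc.measurable.comp (by fun_prop))).aestronglyMeasurable

theorem integrable_mul_comp_exp (hγ : Measurable γ) (hγi : Integrable γ Pr)
    (hγ0 : ∀ᵐ ω ∂Pr, 0 < γ ω) (hHc : Continuous H) (hH : StrictMonoOn H (Set.Icc 0 1))
    (hH0 : H 0 = 0) {b P : ℝ} (hb : 0 < b) (hP : 0 ≤ P) :
    Integrable (fun ω ↦ γ ω * H (Real.exp (-(b * P * γ ω)))) Pr :=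
  (hγi.mul_const (H 1)).mono' (aestronglyMeasurable_mul_comp_exp hγ hHc b P)
    (ae_norm_mul_comp_exp_le hγ0 hH hH0 hb hP)

theorem continuousOn_integral_mul_comp_exp (hγ : Measurable γ) (hγi : Integrable γ Pr)
    (hγ0 : ∀ᵐ ω ∂Pr, 0 < γ ω) (hHc : Continuous H) (hH : StrictMonoOn H (Set.Icc 0 1))
    (hH0 : H 0 = 0) {b : ℝ} (hb : 0 < b) :
    ContinuousOn (fun P ↦ ∫ ω, γ ω * H (Real.exp (-(b * P * γ ω))) ∂Pr) (Set.Ici 0) :=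
  continuousOn_of_dominated (fun P _ ↦ aestronglyMeasurable_mul_comp_exp hγ hHc b P)
    (fun _ hP ↦ ae_norm_mul_comp_exp_le hγ0 hH hH0 hb hP) (hγi.mul_const (H 1))
    (.of_forall fun _ ↦ by fun_prop)

theorem tendsto_integral_mul_comp_exp_atTop (hγ : Measurable γ) (hγi : Integrable γ Pr)
    (hγ0 : ∀ᵐ ω ∂Pr, 0 < γ ω) (hHc : Continuous H) (hH : StrictMonoOn H (Set.Icc 0 1))
    (hH0 : H 0 = 0) {b : ℝ} (hb : 0 < b) :
    Tendsto (fun P ↦ ∫ ω, γ ω * H (Real.exp (-(b * P * γ ω))) ∂Pr) atTop (𝓝 0) := by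
  rw [← integral_zero Ω ℝ (μ := Pr)]
  refine tendsto_integral_filter_of_dominated_convergence (fun ω ↦ γ ω * H 1)
    (.of_forall fun P ↦ aestronglyMeasurable_mul_comp_exp hγ hHc b P)
    ((eventually_ge_atTop 0).mono fun _ hP ↦ ae_norm_mul_comp_exp_le hγ0 hH hH0 hb hP)
    (hγi.mul_const (H 1)) ?_
  filter_upwards [hγ0] with ω hω
  have h : Tendsto (fun P : ℝ ↦ Real.exp (-(b * P * γ ω))) atTop (𝓝 0) :=
    Real.tendsto_exp_neg_atTop_nhds_zero.comp
      ((tendsto_id.const_mul_atTop hb).atTop_mul_const hω)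
  simpa [hH0] using ((hHc.tendsto 0).comp h).const_mul (γ ω)

theorem strictAntiOn_integral_mul_comp_exp [NeZero Pr] (hγ : Measurable γ)
    (hγi : Integrable γ Pr) (hγ0 : ∀ᵐ ω ∂Pr, 0 < γ ω) (hHc : Continuous H)
    (hH : StrictMonoOn H (Set.Icc 0 1)) (hH0 : H 0 = 0) {b : ℝ} (hb : 0 < b) :
    StrictAntiOn (fun P ↦ ∫ ω, γ ω * H (Real.exp (-(b * P * γ ω))) ∂Pr) (Set.Ici 0) := by
  intro P hP Q hQ hPQ
  have hiP := integrable_mul_comp_exp hγ hγi hγ0 hHc hH hH0 hb hP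
  have hiQ := integrable_mul_comp_exp hγ hγi hγ0 hHc hH hH0 hb hQ
  have hlt : ∀ᵐ ω ∂Pr, γ ω * H (Real.exp (-(b * Q * γ ω))) <
      γ ω * H (Real.exp (-(b * P * γ ω))) := by
    filter_upwards [hγ0] with ω hω
    have hmem : ∀ R : ℝ, 0 ≤ R → Real.exp (-(b * R * γ ω)) ∈ Set.Icc (0 : ℝ) 1 := fun R hR ↦
      ⟨(Real.exp_pos _).le, Real.exp_le_one_iff.2 (neg_nonpos.2 (by positivity))⟩
    exact mul_lt_mul_of_pos_left
      (hH (hmem Q hQ) (hmem P hP) (Real.exp_lt_exp.2 (by gcongr))) hω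
  refine (integral_mono_ae hiQ hiP (hlt.mono fun _ h ↦ h.le)).lt_of_ne fun heq ↦ ?_
  have hae := (integral_eq_iff_of_ae_le hiQ hiP (hlt.mono fun _ h ↦ h.le)).1 heq
  obtain ⟨ω, h1, h2⟩ := (hlt.and hae).exists
  exact h1.ne h2

end ExpectationMulCompExp

/-- A strictly decreasing continuous function on `[0, ∞)` tending to `0` at infinity takes each
value in `(0, f 0]` exactly once. -/
theorem existsUnique_eq_of_strictAntiOn_of_tendsto_zero {f : ℝ → ℝ}
    (hf : StrictAntiOn f (Set.Ici 0)) (hc : ContinuousOn f (Set.Ici 0))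
    (hlim : Tendsto f atTop (𝓝 0)) {y : ℝ} (hy : 0 < y) (hy0 : y ≤ f 0) :
    ∃! x : ℝ, 0 ≤ x ∧ y = f x := by
  obtain ⟨M, hM, hM0⟩ := ((hlim.eventually (gt_mem_nhds hy)).and (eventually_ge_atTop 0)).exists
  obtain ⟨x, hx, hxy⟩ := intermediate_value_Icc' hM0 (hc.mono Set.Icc_subset_Ici_self)
    ⟨hM.le, hy0⟩
  exact ⟨x, ⟨hx.1, hxy.symm⟩, fun z hz ↦ hf.injOn hz.1 hx.1 (hz.2.symm.trans hxy.symm)⟩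

theorem one_sub_mul_mul_mem_Icc {a r t : ℝ} (ha : 0 ≤ a) (hr : 0 ≤ r)
    (ht : t ∈ Set.Icc (0 : ℝ) 1) : (1 - a * t) * r ∈ Set.Icc ((1 - a) * r) r := by
  constructor
  · exact mul_le_mul_of_nonneg_right (by nlinarith [ht.2]) hr
  · exact mul_le_of_le_one_left hr (by nlinarith [mul_nonneg ha ht.1])

theorem strictMonoOn_comp_mul_of_antitoneOn {a r : ℝ} (ha : 0 ≤ a) (hr : 0 ≤ r) {D : ℝ → ℝ}
    (hDanti : AntitoneOn D (Set.Icc ((1 - a) * r) r))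
    (hDpos : ∀ x ∈ Set.Icc ((1 - a) * r) r, 0 < D x) :
    StrictMonoOn (fun t ↦ D ((1 - a * t) * r) * t) (Set.Icc 0 1) := by
  intro s hs t ht hst
  have hs' := one_sub_mul_mul_mem_Icc ha hr hs
  have ht' := one_sub_mul_mul_mem_Icc ha hr ht
  have hD : D ((1 - a * s) * r) ≤ D ((1 - a * t) * r) := hDanti ht' hs' (by gcongr)
  exact mul_lt_mul' hD hst hs.1 (hDpos _ ht')

theorem stmt_5 {Ω : Type*} [MeasurableSpace Ω] (Pr : Measure Ω)
    [IsProbabilityMeasure Pr] (γ : Ω → ℝ) (hγmeas : Measurable γ)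
    (hγint : Integrable γ Pr) (hγ0 : ∀ᵐ ω ∂Pr, 0 < γ ω)
    (a b r : ℝ) (ha : 0 < a) (ha1 : a ≤ 1) (hb : 0 < b) (hr : 0 < r)
    (D : ℝ → ℝ) (hDcont : ContinuousOn D (Set.Icc ((1 - a) * r) r))
    (hDanti : AntitoneOn D (Set.Icc ((1 - a) * r) r))
    (hDpos : ∀ x ∈ Set.Icc ((1 - a) * r) r, 0 < D x)
    (φ : ℝ → ℝ)
    (hφ : ∀ P : ℝ,
      φ P = a * b * r *
        ∫ ω, D ((1 - a * Real.exp (-(b * P * γ ω))) * r) * γ ω *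
          Real.exp (-(b * P * γ ω)) ∂Pr)
    (hφ0 : φ 0 = a * b * r * (D ((1 - a) * r) * ∫ ω, γ ω ∂Pr)) :
    ∀ μ : ℝ, 0 < μ → μ ≤ φ 0 → ∃! P : ℝ, 0 ≤ P ∧ μ = φ P := by
  intro μ hμ hμ0
  have hle : (1 - a) * r ≤ r := mul_le_of_le_one_left hr.le (by linarith)
  let G : ℝ → ℝ := Set.IccExtend hle ((Set.Icc ((1 - a) * r) r).domRestrict D)
  have hGD : Set.EqOn G D (Set.Icc ((1 - a) * r) r) := fun x hx ↦ by
    simp [G, Set.IccExtend_of_mem _ _ hx]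
  have hGc : Continuous G := (continuousOn_iff_continuous_domRestrict.1 hDcont).Icc_extend'
  let H : ℝ → ℝ := fun t ↦ G ((1 - a * t) * r) * t
  have hHc : Continuous H := by fun_prop
  have hH : StrictMonoOn H (Set.Icc 0 1) :=
    strictMonoOn_comp_mul_of_antitoneOn ha.le hr.le (hDanti.congr hGD.symm)
      fun x hx ↦ (hGD hx).symm ▸ hDpos x hx
  have hH0 : H 0 = 0 := by simp [H]
  have hc : 0 < a * b * r := by positivity
  have hφH : Set.EqOn (fun P ↦ a * b * r * ∫ ω, γ ω * H (Real.exp (-(b * P * γ ω))) ∂Pr) φ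
      (Set.Ici 0) := by
    intro P hP
    have hP' : 0 ≤ P := hP
    simp only [hφ]
    congr 1
    refine integral_congr_ae ?_
    filter_upwards [hγ0] with ω hω
    have ht : Real.exp (-(b * P * γ ω)) ∈ Set.Icc (0 : ℝ) 1 :=
      ⟨(Real.exp_pos _).le, Real.exp_le_one_iff.2 (neg_nonpos.2 (by positivity))⟩
    simp only [H, hGD (one_sub_mul_mul_mem_Icc ha.le hr.le ht)]
    ring
  refine existsUnique_eq_of_strictAntiOn_of_tendsto_zero ?_ ?_ ?_ hμ hμ0
  · refine StrictAntiOn.congr (fun P hP Q hQ hPQ ↦ ?_) hφH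
    exact mul_lt_mul_of_pos_left
      (strictAntiOn_integral_mul_comp_exp hγmeas hγint hγ0 hHc hH hH0 hb hP hQ hPQ) hc
  · exact ((continuousOn_integral_mul_comp_exp hγmeas hγint hγ0 hHc hH hH0 hb).const_mul
      _).congr hφH.symm
  · have h := (tendsto_integral_mul_comp_exp_atTop hγmeas hγint hγ0 hHc hH hH0 hb).const_mul
      (a * b * r)
    rw [mul_zero] at h
    exact h.congr' ((eventually_ge_atTop 0).mono fun P hP ↦ hφH hP)
end

section
/- Let (Ω, ℙ) be a probability space and let γ : Ω → ℝ be measurable and integrable with γ(ω) > 0 for ℙ-almost every ω. Let a ∈ (0,1], b > 0, r > 0, and let D : ℝ → ℝ be measurable, antitone and strictly positive on [(1−a)·r, r]. Suppose 0 < μ₁ < μ₂ and that P₁, P₂ ∈ [0, ∞) satisfy μᵢ = a·b·r·∫ D((1 − a·exp(−b·Pᵢ·γ(ω)))·r) · γ(ω) · exp(−b·Pᵢ·γ(ω)) dℙ(ω) for i = 1, 2. Then P₂ < P₁. -/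
open MeasureTheory

theorem stmt_7 {Ω : Type*} [MeasurableSpace Ω] (Pr : Measure Ω)
    [IsProbabilityMeasure Pr] (γ : Ω → ℝ) (hγmeas : Measurable γ)
    (hγint : Integrable γ Pr) (hγ0 : ∀ᵐ ω ∂Pr, 0 < γ ω)
    (a b r : ℝ) (ha : 0 < a) (ha1 : a ≤ 1) (hb : 0 < b) (hr : 0 < r)
    (D : ℝ → ℝ) (hDmeas : Measurable D)
    (hDanti : AntitoneOn D (Set.Icc ((1 - a) * r) r))
    (hDpos : ∀ x ∈ Set.Icc ((1 - a) * r) r, 0 < D x)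
    (μ₁ μ₂ P₁ P₂ : ℝ) (hμ1 : 0 < μ₁) (hμ12 : μ₁ < μ₂)
    (hP1 : 0 ≤ P₁) (hP2 : 0 ≤ P₂)
    (heq1 : μ₁ = a * b * r *
      ∫ ω, D ((1 - a * Real.exp (-(b * P₁ * γ ω))) * r) * γ ω *
        Real.exp (-(b * P₁ * γ ω)) ∂Pr)
    (heq2 : μ₂ = a * b * r *
      ∫ ω, D ((1 - a * Real.exp (-(b * P₂ * γ ω))) * r) * γ ω *
        Real.exp (-(b * P₂ * γ ω)) ∂Pr) :
    P₂ < P₁ := by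
  by_contra! hP
  have hmem : ∀ P g : ℝ, 0 ≤ P → 0 < g →
      (1 - a * Real.exp (-(b * P * g))) * r ∈ Set.Icc ((1 - a) * r) r := by
    intro P g hP0 hg
    have hexp : Real.exp (-(b * P * g)) ≤ 1 := Real.exp_le_one_iff.2 (by
      have : 0 ≤ b * P * g := by positivity
      linarith)
    have hpos : 0 < a * Real.exp (-(b * P * g)) := by positivity
    have hle : a * Real.exp (-(b * P * g)) ≤ a := mul_le_of_le_one_right ha.le hexp
    exact ⟨mul_le_mul_of_nonneg_right (by linarith) hr.le,
      mul_le_of_le_one_left hr.le (by linarith)⟩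
  have hint : Integrable (fun ω ↦ D ((1 - a * Real.exp (-(b * P₁ * γ ω))) * r) * γ ω *
      Real.exp (-(b * P₁ * γ ω))) Pr := by
    by_contra h
    rw [integral_undef h, mul_zero] at heq1
    exact hμ1.ne' heq1
  refine hμ12.not_ge ?_
  rw [heq1, heq2]
  refine mul_le_mul_of_nonneg_left (integral_mono_of_nonneg ?_ hint ?_) (by positivity)
  · filter_upwards [hγ0] with ω hω
    have := hDpos _ (hmem P₂ (γ ω) hP2 hω)
    simp only [Pi.zero_apply]
    positivity
  · filter_upwards [hγ0] with ω hω
    have hexp : Real.exp (-(b * P₂ * γ ω)) ≤ Real.exp (-(b * P₁ * γ ω)) :=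
      Real.exp_le_exp.2 (by gcongr)
    have hD := hDanti (hmem P₁ (γ ω) hP1 hω) (hmem P₂ (γ ω) hP2 hω) (by gcongr)
    have hD1 := hDpos _ (hmem P₁ (γ ω) hP1 hω)
    exact mul_le_mul (mul_le_mul_of_nonneg_right hD hω.le) hexp (Real.exp_nonneg _)
      (by positivity)
end

section
/- Let (Ω, ℙ) be a probability space, let γ : Ω → ℝ be measurable with γ(ω) ≥ 0 for ℙ-almost every ω, let a ∈ (0,1], b ≥ 0, r ≥ 0, and let U : ℝ → ℝ be concave, monotone nondecreasing and measurable. Then the function f(I, x) = −I · ∫ U((1 − a·exp(−b·γ(ω)·x/I))·r) dℙ(ω) is convex on the convex set {(I, x) ∈ ℝ × ℝ : 0 < I ≤ 1 and 0 ≤ x}. -/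
open MeasureTheory

theorem concaveOn_mul_comp_div {h : ℝ → ℝ} (hh : ConcaveOn ℝ (Set.Ici 0) h) :
    ConcaveOn ℝ {p : ℝ × ℝ | 0 < p.1 ∧ 0 ≤ p.2} (fun p => p.1 * h (p.2 / p.1)) := by
  refine ⟨((convex_Ioi (0 : ℝ)).prod (convex_Ici (0 : ℝ))), ?_⟩
  rintro ⟨I, x⟩ ⟨hI, hx⟩ ⟨J, y⟩ ⟨hJ, hy⟩ s t hs ht hst
  simp only [smul_eq_mul, Prod.smul_mk, Prod.mk_add_mk] at *
  have hK : 0 < s * I + t * J := by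
    rcases hs.eq_or_lt with rfl | hs
    · obtain rfl : t = 1 := by linarith
      simpa using hJ
    · positivity
  have key := hh.2 (Set.mem_Ici.2 (div_nonneg hx hI.le)) (Set.mem_Ici.2 (div_nonneg hy hJ.le))
    (show 0 ≤ s * I / (s * I + t * J) by positivity)
    (show 0 ≤ t * J / (s * I + t * J) by positivity) (by field_simp)
  simp only [smul_eq_mul] at key
  have hpt : s * I / (s * I + t * J) * (x / I) + t * J / (s * I + t * J) * (y / J)
      = (s * x + t * y) / (s * I + t * J) := by
    field_simp
  rw [hpt] at key
  have hmul := mul_le_mul_of_nonneg_left key hK.le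
  refine le_of_eq_of_le ?_ hmul
  field_simp

theorem ConcaveOn.integral_of_ae {Ω E : Type*} [MeasurableSpace Ω] {μ : Measure Ω}
    [AddCommGroup E] [Module ℝ E] {s : Set E} {f : Ω → E → ℝ} (hs : Convex ℝ s)
    (hf : ∀ᵐ ω ∂μ, ConcaveOn ℝ s (f ω)) (hint : ∀ x ∈ s, Integrable (fun ω => f ω x) μ) :
    ConcaveOn ℝ s (fun x => ∫ ω, f ω x ∂μ) := by
  refine ⟨hs, fun x hx y hy c d hc hd hcd => ?_⟩
  simp only [smul_eq_mul]
  rw [← integral_const_mul, ← integral_const_mul,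
    ← integral_add ((hint x hx).const_mul c) ((hint y hy).const_mul d)]
  refine integral_mono_ae (((hint x hx).const_mul c).add ((hint y hy).const_mul d))
    (hint _ (hs hx hy hc hd hcd)) ?_
  filter_upwards [hf] with ω hω
  exact hω.2 hx hy hc hd hcd

theorem concaveOn_one_sub_mul_exp_mul {a r : ℝ} (ha : 0 ≤ a) (hr : 0 ≤ r) (c : ℝ) :
    ConcaveOn ℝ Set.univ (fun t : ℝ => (1 - a * Real.exp (-(c * t))) * r) := by
  refine ⟨convex_univ, fun x _ y _ s t hs ht hst => ?_⟩
  have hexp := convexOn_exp.2 (Set.mem_univ (-(c * x))) (Set.mem_univ (-(c * y))) hs ht hst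
  simp only [smul_eq_mul] at hexp ⊢
  rw [show s * -(c * x) + t * -(c * y) = -(c * (s * x + t * y)) by ring] at hexp
  have hmul := mul_le_mul_of_nonneg_left hexp (mul_nonneg ha hr)
  linear_combination hmul + r * hst

theorem stmt_9 {Ω : Type*} [MeasurableSpace Ω] (Pr : Measure Ω)
    [IsProbabilityMeasure Pr] (γ : Ω → ℝ) (hγmeas : Measurable γ)
    (hγ0 : ∀ᵐ ω ∂Pr, 0 ≤ γ ω)
    (a b r : ℝ) (ha : 0 < a) (ha1 : a ≤ 1) (hb : 0 ≤ b) (hr : 0 ≤ r)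
    (U : ℝ → ℝ) (hUconc : ConcaveOn ℝ Set.univ U) (hUmono : Monotone U)
    (hUmeas : Measurable U) :
    ConvexOn ℝ {p : ℝ × ℝ | (0 < p.1 ∧ p.1 ≤ 1) ∧ 0 ≤ p.2}
      (fun p : ℝ × ℝ =>
        -p.1 * ∫ ω, U ((1 - a * Real.exp (-(b * γ ω * p.2 / p.1))) * r) ∂Pr) := by
  have hconc : ConcaveOn ℝ (Set.Ici 0)
      (fun t : ℝ => ∫ ω, U ((1 - a * Real.exp (-(b * γ ω * t))) * r) ∂Pr) := by
    refine ConcaveOn.integral_of_ae (convex_Ici 0) (.of_forall fun ω => ?_) fun t ht => ?_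
    · have hin := concaveOn_one_sub_mul_exp_mul ha.le hr (b * γ ω)
      refine ⟨convex_Ici 0, fun x _ y _ s t hs ht hst => ?_⟩
      exact (hUconc.2 trivial trivial hs ht hst).trans
        (hUmono (hin.2 (Set.mem_univ x) (Set.mem_univ y) hs ht hst))
    · refine Integrable.of_mem_Icc (U 0) (U r) (by fun_prop) ?_
      filter_upwards [hγ0] with ω hω
      have hexp : Real.exp (-(b * γ ω * t)) ≤ 1 :=
        Real.exp_le_one_iff.2 (neg_nonpos.2 (mul_nonneg (mul_nonneg hb hω) ht))
      have hpos := Real.exp_pos (-(b * γ ω * t))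
      refine ⟨hUmono (mul_nonneg (sub_nonneg.2 (mul_le_one₀ ha1 hpos.le hexp)) hr),
        hUmono (mul_le_of_le_one_left hr ?_)⟩
      linarith [mul_pos ha hpos]
  have hset : Convex ℝ {p : ℝ × ℝ | (0 < p.1 ∧ p.1 ≤ 1) ∧ 0 ≤ p.2} :=
    (convex_Ioc (0 : ℝ) 1).prod (convex_Ici (0 : ℝ))
  have hpersp := ((concaveOn_mul_comp_div hconc).subset (fun p hp => ⟨hp.1.1, hp.2⟩) hset).neg
  refine hpersp.congr fun p _ => ?_
  simp only [Pi.neg_apply, neg_mul, mul_div_assoc]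
end

section
/- Let (Ω, ℙ) be a probability space and let γ : Ω → ℝ be measurable and integrable with γ(ω) ≥ 0 for ℙ-almost every ω. Let a ∈ (0,1], b ≥ 0, r ≥ 0, and let U : ℝ → ℝ be concave on ℝ, monotone nondecreasing, measurable, and differentiable at (1−a)·r. If μ ≥ a·b·r·U'((1−a)·r)·∫ γ dℙ, then for every P ≥ 0, ∫ U((1 − a·exp(−b·γ(ω)·P))·r) dℙ(ω) − μ·P ≤ U((1−a)·r); i.e., P = 0 maximizes the μ-penalized expected utility P ↦ E[U((1 − a·e^{−b·P·γ})·r)] − μ·P over [0, ∞). -/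
open MeasureTheory

/-- A concave function lies below its tangent line, to the right of the point of tangency. -/
theorem ConcaveOn.le_tangent_right {U : ℝ → ℝ} (hU : ConcaveOn ℝ Set.univ U) {x y : ℝ}
    (hd : DifferentiableAt ℝ U x) (hxy : x ≤ y) : U y ≤ U x + deriv U x * (y - x) := by
  rcases hxy.eq_or_lt with rfl | hlt
  · simp
  · have h := hU.slope_le_deriv (Set.mem_univ x) (Set.mem_univ y) hlt hd
    rw [slope_def_field, div_le_iff₀ (sub_pos.2 hlt)] at h
    linarith

theorem stmt_13 {Ω : Type*} [MeasurableSpace Ω] (Pr : Measure Ω)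
    [IsProbabilityMeasure Pr] (γ : Ω → ℝ) (hγmeas : Measurable γ)
    (hγint : Integrable γ Pr) (hγ0 : ∀ᵐ ω ∂Pr, 0 ≤ γ ω)
    (a b r : ℝ) (ha : 0 < a) (ha1 : a ≤ 1) (hb : 0 ≤ b) (hr : 0 ≤ r)
    (U : ℝ → ℝ) (hUconc : ConcaveOn ℝ Set.univ U) (hUmono : Monotone U)
    (hUmeas : Measurable U) (hUdiff : DifferentiableAt ℝ U ((1 - a) * r))
    (μ : ℝ) (hμ : a * b * r * deriv U ((1 - a) * r) * (∫ ω, γ ω ∂Pr) ≤ μ) :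
    ∀ P : ℝ, 0 ≤ P →
      (∫ ω, U ((1 - a * Real.exp (-(b * γ ω * P))) * r) ∂Pr) - μ * P
        ≤ U ((1 - a) * r) := by
  intro P hP
  set x := (1 - a) * r with hx
  have hd : 0 ≤ deriv U x := hUmono.deriv_nonneg
  have hlow : ∀ᵐ ω ∂Pr, x ≤ (1 - a * Real.exp (-(b * γ ω * P))) * r := by
    filter_upwards [hγ0] with ω hω
    have hexp : Real.exp (-(b * γ ω * P)) ≤ 1 :=
      Real.exp_le_one_iff.2 (neg_nonpos.2 (by positivity))
    rw [hx]
    gcongr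
    nlinarith
  have hint : Integrable (fun ω ↦ U ((1 - a * Real.exp (-(b * γ ω * P))) * r)) Pr := by
    refine Integrable.of_mem_Icc (U x) (U r) (by fun_prop) ?_
    filter_upwards [hlow] with ω hω
    refine ⟨hUmono hω, hUmono ?_⟩
    have : 0 ≤ a * Real.exp (-(b * γ ω * P)) * r := by positivity
    linarith
  have hbound : ∀ᵐ ω ∂Pr, U ((1 - a * Real.exp (-(b * γ ω * P))) * r) ≤
      U x + a * b * r * deriv U x * P * γ ω := by
    filter_upwards [hlow] with ω hω
    refine (hUconc.le_tangent_right hUdiff hω).trans ?_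
    have hexp : 1 - Real.exp (-(b * γ ω * P)) ≤ b * γ ω * P := by
      linarith [Real.add_one_le_exp (-(b * γ ω * P))]
    calc _ = U x + deriv U x * (a * r * (1 - Real.exp (-(b * γ ω * P)))) := by rw [hx]; ring
      _ ≤ U x + deriv U x * (a * r * (b * γ ω * P)) := by gcongr
      _ = _ := by ring
  have hle := integral_mono_ae hint ((integrable_const (U x)).add (hγint.const_mul _)) hbound
  have heq : ∫ ω, (U x + a * b * r * deriv U x * P * γ ω) ∂Pr =
      U x + a * b * r * deriv U x * P * ∫ ω, γ ω ∂Pr := by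
    rw [integral_add (integrable_const _) (hγint.const_mul _), integral_const_mul]
    simp
  have hμP := mul_le_mul_of_nonneg_right hμ hP
  have hle' := hle.trans_eq heq
  linarith
end
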